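/- Let γ∈(0,1/3], V(x)=|x|^{γ+1}/(γ+1), x₀≠0, δ(ε)=ε^{(1−γ)/(1+γ)}, n ≥ 1 an integer, and w_ε := ε^{(1−γ)/(1+γ)}. Suppose 0 < λ₁ < λ₂ < … < λ_n are reals and ψ₁,…,ψ_n:ℝ→ℝ are twice continuously differentiable functions, none identically zero, with −ψ_k'' + V'ψ_k' = λ_k ψ_k on ℝ and ∫_ℝ ψ_k(x)² e^{−V(x)} dx < ∞ for each k. For ε∈(0,1] set λ_{k,ε} := λ_k·ε^{(γ−1)/(γ+1)}, ψ_{k,ε}(x) := ψ_k(x·ε^{−1/(1+γ)}), c_{k,ε} := (1/(2δ(ε)))·∫_{x₀−δ(ε)}^{x₀+δ(ε)} ψ_{k,ε}(x) dx, and d_{n,ε}(t) := ( Σ_{k=1}^{n} e^{−2λ_{k,ε} t}·c_{k,ε}² )^{1/2}. Then for all sufficiently small ε one has |c_{n,ε}| > 1, so that t_ε := λ_{n,ε}^{−1}·log|c_{n,ε}| is well-defined and positive, and profile cut-off holds at time t_ε with window w_ε and profile 𝔭(r) = e^{−λ_n r}: for every r∈ℝ, lim_{ε→0} d_{n,ε}(t_ε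 + r·w_ε) = e^{−λ_n r}. -/

import Mathlib

open Real Filter MeasureTheory

/-- The monomial convex potential `V(x) = |x|^(γ+1)/(γ+1)`. -/
noncomputable def Vpot (γ x : ℝ) : ℝ := |x| ^ (γ + 1) / (γ + 1)

/-- The derivative of the potential, `V'(x) = sign(x)·|x|^γ`. -/
noncomputable def Vp (γ x : ℝ) : ℝ := Real.sign x * |x| ^ γ

/-- The spatial scale `δ(ε) = ε^{(1−γ)/(1+γ)}` (also the time window `w_ε`). -/
noncomputable def delta (γ ε : ℝ) : ℝ := ε ^ ((1 - γ) / (1 + γ))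

/-- The Fourier coefficient `c_{k,ε} = (1/(2δ(ε)))·∫_{x₀−δ(ε)}^{x₀+δ(ε)}
ψ(x·ε^{−1/(1+γ)}) dx` of the uniform density on `B_{δ(ε)}(x₀)` against the
rescaled eigenfunction `ψ_{k,ε}(x) = ψ_k(x·ε^{−1/(1+γ)})`. -/
noncomputable def fCoeff (γ x₀ : ℝ) (ψ : ℝ → ℝ) (ε : ℝ) : ℝ :=
  (1 / (2 * delta γ ε)) *
    ∫ x in (x₀ - delta γ ε)..(x₀ + delta γ ε), ψ (x * ε ^ (-(1 : ℝ) / (1 + γ)))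

/-- The truncated χ²-distance
`d_{n,ε}(t) = (Σ_{k=1}^n e^{−2λ_{k,ε}t}·c_{k,ε}²)^{1/2}` with
`λ_{k,ε} = λ_k·ε^{(γ−1)/(γ+1)}`. -/
noncomputable def truncDist (γ : ℝ) (n : ℕ) (lam : ℕ → ℝ) (ψ : ℕ → ℝ → ℝ)
    (x₀ ε t : ℝ) : ℝ :=
  Real.sqrt (∑ k ∈ Finset.Icc 1 n,
    Real.exp (-2 * (lam k * ε ^ ((γ - 1) / (γ + 1))) * t)
      * (fCoeff γ x₀ (ψ k) ε) ^ 2)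

/-- The cut-off time `t_ε = λ_{n,ε}^{−1}·log |c_{n,ε}|` built from the mode
with eigenvalue `lam`. -/
noncomputable def cutoffTime (γ lam x₀ : ℝ) (ψ : ℝ → ℝ) (ε : ℝ) : ℝ :=
  (lam * ε ^ ((γ - 1) / (γ + 1)))⁻¹ * Real.log |fCoeff γ x₀ ψ ε|


/-- A nonzero, twice continuously differentiable eigenfunction of `-L₁` with eigenvalue `lam`,
square integrable with respect to `e^{-V}`. -/
structure IsEigenfunction (γ lam : ℝ) (ψ : ℝ → ℝ) : Prop where
  smooth : ContDiff ℝ 2 ψ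
  ne_zero : ∃ x, ψ x ≠ 0
  ode : ∀ x : ℝ, -(deriv (deriv ψ) x) + Vp γ x * deriv ψ x = lam * ψ x
  sq_integrable : Integrable (fun x => (ψ x) ^ 2 * Real.exp (-(Vpot γ x)))

/-! ### Elementary differential inequalities -/

lemma eventually_lt_of_hasDerivAt_pos {f : ℝ → ℝ} {f' x : ℝ} (h : HasDerivAt f f' x)
    (hf' : 0 < f') : ∀ᶠ y in nhdsWithin x (Set.Ioi x), f x < f y := by
  have h1 := h.hasDerivWithinAt (s := Set.Ioi x)
  rw [hasDerivWithinAt_iff_tendsto_slope' (by simp)] at h1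
  filter_upwards [h1.eventually (lt_mem_nhds hf'), self_mem_nhdsWithin] with y hy hxy
  rw [slope_def_field] at hy
  have hxy' : 0 < y - x := sub_pos.2 hxy
  have := (div_pos_iff_of_pos_right hxy').1 hy
  linarith

/-- If the quadrant `{f ≥ f a, g ≥ g a}` is pointing inwards along the pair `(f, g)`, then the pair
never leaves it. -/
lemma forward_invariant {f g f' g' : ℝ → ℝ} {a : ℝ}
    (hf : ∀ x, a ≤ x → HasDerivAt f (f' x) x) (hg : ∀ x, a ≤ x → HasDerivAt g (g' x) x)
    (hpos : ∀ x, a ≤ x → f a ≤ f x → g a ≤ g x → 0 < f' x ∧ 0 < g' x) {x : ℝ} (hx : a ≤ x) :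
    f a ≤ f x ∧ g a ≤ g x := by
  have hfc : ContinuousOn f (Set.Icc a x) := fun y hy => (hf y hy.1).continuousAt.continuousWithinAt
  have hgc : ContinuousOn g (Set.Icc a x) := fun y hy => (hg y hy.1).continuousAt.continuousWithinAt
  have hcl : IsClosed ({y | f a ≤ f y ∧ g a ≤ g y} ∩ Set.Icc a x) := by
    have h1 := hfc.preimage_isClosed_of_isClosed isClosed_Icc (isClosed_Ici (a := f a))
    have h2 := hgc.preimage_isClosed_of_isClosed isClosed_Icc (isClosed_Ici (a := g a))
    convert h1.inter h2 using 1
    ext y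
    simp only [Set.mem_inter_iff, Set.mem_ofPred_eq, Set.mem_preimage, Set.mem_Ici]
    tauto
  refine hcl.Icc_subset_of_forall_mem_nhdsWithin (by simp) ?_ ⟨hx, le_rfl⟩
  rintro y ⟨⟨hy1, hy2⟩, hy⟩
  obtain ⟨h1, h2⟩ := hpos y hy.1 hy1 hy2
  filter_upwards [eventually_lt_of_hasDerivAt_pos (hf y hy.1) h1,
    eventually_lt_of_hasDerivAt_pos (hg y hy.1) h2] with z hz1 hz2
  exact ⟨hy1.trans hz1.le, hy2.trans hz2.le⟩

lemma le_of_hasDerivAt_nonneg {f f' : ℝ → ℝ} {a : ℝ}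
    (hf : ∀ x, a ≤ x → HasDerivAt f (f' x) x) (h : ∀ x, a ≤ x → 0 ≤ f' x)
    {x : ℝ} (hx : a ≤ x) : f a ≤ f x := by
  have : MonotoneOn f (Set.Ici a) := by
    refine monotoneOn_of_deriv_nonneg (convex_Ici a)
      (fun y hy => (hf y hy).continuousAt.continuousWithinAt)
      (fun y hy => (hf y (interior_subset hy)).differentiableAt.differentiableWithinAt) ?_
    intro y hy
    rw [(hf y (interior_subset hy)).deriv]
    exact h y (interior_subset hy)
  exact this (Set.mem_Ici.2 le_rfl) hx hx

lemma mul_exp_le_of_hasDerivAt {f f' A A' : ℝ → ℝ} {a : ℝ}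
    (hf : ∀ x, a ≤ x → HasDerivAt f (f' x) x) (hA : ∀ x, a ≤ x → HasDerivAt A (A' x) x)
    (h : ∀ x, a ≤ x → A' x * f x ≤ f' x) {x : ℝ} (hx : a ≤ x) :
    f a * exp (A x - A a) ≤ f x := by
  have key := le_of_hasDerivAt_nonneg (f := fun y => f y * exp (-(A y)))
    (f' := fun y => f' y * exp (-(A y)) + f y * (exp (-(A y)) * -(A' y)))
    (fun y hy => (hf y hy).mul (hA y hy).neg.exp)
    (fun y hy => by
      have := mul_nonneg (sub_nonneg.2 (h y hy)) (exp_pos (-(A y))).le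
      linarith) hx
  have h2 := mul_le_mul_of_nonneg_right key (exp_pos (A x)).le
  simp only [mul_assoc, ← exp_add] at h2
  simpa [sub_eq_neg_add] using h2

namespace IsEigenfunction

variable {γ lam : ℝ} {ψ : ℝ → ℝ}

lemma hasDerivAt (h : IsEigenfunction γ lam ψ) (x : ℝ) : HasDerivAt ψ (deriv ψ x) x :=
  (h.smooth.differentiable (by norm_num) x).hasDerivAt

lemma hasDerivAt_deriv (h : IsEigenfunction γ lam ψ) (x : ℝ) :
    HasDerivAt (deriv ψ) (Vp γ x * deriv ψ x - lam * ψ x) x := by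
  have h1 : ContDiff ℝ 1 (deriv ψ) := by
    have h2 : ContDiff ℝ (1 + 1) ψ := by
      have := h.smooth
      norm_num
      exact this
    exact (contDiff_succ_iff_deriv.1 h2).2.2
  have h2 := (h1.differentiable (by norm_num) x).hasDerivAt
  have h3 : Vp γ x * deriv ψ x - lam * ψ x = deriv (deriv ψ) x := by
    linarith [h.ode x]
  rwa [h3]

lemma neg (h : IsEigenfunction γ lam ψ) : IsEigenfunction γ lam (-ψ) where
  smooth := h.smooth.neg
  ne_zero := by
    obtain ⟨x, hx⟩ := h.ne_zero
    exact ⟨x, by simpa using hx⟩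
  ode x := by
    have h1 : deriv (-ψ) = -deriv ψ := by
      ext y
      simp [deriv.neg]
    have h2 : deriv (-deriv ψ) x = -deriv (deriv ψ) x := deriv.neg
    rw [h1, h2]
    simp only [Pi.neg_apply]
    linarith [h.ode x]
  sq_integrable := by simpa using h.sq_integrable

lemma comp_neg (h : IsEigenfunction γ lam ψ) : IsEigenfunction γ lam (fun x => ψ (-x)) where
  smooth := h.smooth.comp contDiff_neg
  ne_zero := by
    obtain ⟨x, hx⟩ := h.ne_zero
    exact ⟨-x, by simpa using hx⟩
  ode x := by
    have h1 : deriv (fun x => ψ (-x)) = fun x => -deriv ψ (-x) := by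
      ext y
      exact deriv_comp_neg ψ y
    have h2 : deriv (fun x => -deriv ψ (-x)) x = deriv (deriv ψ) (-x) := by
      have := deriv_comp_neg (deriv ψ) x
      rw [deriv.fun_neg, this, neg_neg]
    have h3 : Vp γ (-x) = -Vp γ x := by
      unfold Vp
      rw [abs_neg, Real.sign_neg]
      ring
    have := h.ode (-x)
    rw [h3] at this
    rw [h1, h2]
    linarith
  sq_integrable := by
    have := h.sq_integrable.comp_neg
    simpa [Vpot] using this

lemma abs_Vp_le (hγ0 : 0 ≤ γ) (hγ1 : γ ≤ 1) (x : ℝ) : |Vp γ x| ≤ 1 + |x| := by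
  have hs : |Real.sign x| ≤ 1 := by
    rcases Real.sign_apply_eq x with h | h | h <;> simp [h]
  have hp : |x| ^ γ ≤ 1 + |x| := by
    have h0 : (0 : ℝ) ≤ |x| := abs_nonneg x
    calc |x| ^ γ ≤ (1 + |x|) ^ γ := by gcongr; linarith
      _ ≤ (1 + |x|) ^ (1 : ℝ) := rpow_le_rpow_of_exponent_le (by linarith) hγ1
      _ = 1 + |x| := rpow_one _
  rw [Vp, abs_mul, abs_of_nonneg (rpow_nonneg (abs_nonneg x) γ)]
  calc _ ≤ 1 * |x| ^ γ := by gcongr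
    _ ≤ _ := by simpa using hp

/-- A function with vanishing Cauchy data at some point vanishes to the right of it. -/
lemma eq_zero_right (h : IsEigenfunction γ lam ψ) (hγ0 : 0 ≤ γ) (hγ1 : γ ≤ 1) {a : ℝ}
    (h0 : ψ a = 0) (h1 : deriv ψ a = 0) {x : ℝ} (hx : a ≤ x) : ψ x = 0 := by
  have hE : ∀ y, a ≤ y → HasDerivAt (fun y => -(ψ y ^ 2 + deriv ψ y ^ 2))
      (-(2 * ψ y * deriv ψ y + 2 * deriv ψ y * (Vp γ y * deriv ψ y - lam * ψ y))) y := by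
    intro y _
    have := (((h.hasDerivAt y).fun_pow 2).fun_add ((h.hasDerivAt_deriv y).fun_pow 2)).fun_neg
    simpa using this
  have hA : ∀ y, a ≤ y → HasDerivAt
      (fun y => (1 + |lam| + 2 * (1 + |a|)) * y + (y - a) ^ 2)
      ((1 + |lam| + 2 * (1 + |a|)) + 2 * (y - a)) y := by
    intro y _
    have h1 := ((hasDerivAt_id y).const_mul (1 + |lam| + 2 * (1 + |a|))).fun_add
      (((hasDerivAt_id y).sub_const a).fun_pow 2)
    simpa using h1
  have key := mul_exp_le_of_hasDerivAt hE hA (fun y hy => by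
    have hV := abs_Vp_le hγ0 hγ1 y
    have hy' : |y| ≤ |a| + (y - a) := by
      calc |y| = |a + (y - a)| := by ring_nf
        _ ≤ |a| + |y - a| := abs_add_le _ _
        _ = _ := by rw [abs_of_nonneg (sub_nonneg.2 hy)]
    set p := deriv ψ y
    set f := ψ y
    have e1 : 2 * (Vp γ y) * p ^ 2 ≤ (2 * (1 + |a|) + 2 * (y - a)) * p ^ 2 := by
      gcongr
      linarith [le_abs_self (Vp γ y)]
    have e2 : (1 - lam) * (2 * f * p) ≤ (1 + |lam|) * (f ^ 2 + p ^ 2) := by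
      have b1 : |1 - lam| ≤ 1 + |lam| := by
        simpa using abs_sub (1 : ℝ) lam
      have b2 : |2 * f * p| ≤ f ^ 2 + p ^ 2 := by
        rw [abs_le]
        constructor <;> nlinarith [sq_nonneg (f + p), sq_nonneg (f - p)]
      calc (1 - lam) * (2 * f * p) ≤ |(1 - lam) * (2 * f * p)| := le_abs_self _
        _ = |1 - lam| * |2 * f * p| := abs_mul _ _
        _ ≤ _ := by gcongr
    have e3 : 0 ≤ (2 * (1 + |a|) + 2 * (y - a)) * f ^ 2 := by
      have : 0 ≤ y - a := sub_nonneg.2 hy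
      positivity
    linarith) hx
  simp only [h0, h1] at key
  norm_num at key
  have := sq_nonneg (deriv ψ x)
  have := sq_nonneg (ψ x)
  exact pow_eq_zero_iff (two_ne_zero) |>.1 (by linarith)

lemma deriv_ne_zero (h : IsEigenfunction γ lam ψ) (hγ0 : 0 ≤ γ) (hγ1 : γ ≤ 1) {a : ℝ}
    (h0 : ψ a = 0) : deriv ψ a ≠ 0 := by
  intro h1
  obtain ⟨x, hx⟩ := h.ne_zero
  rcases le_total a x with hax | hax
  · exact hx (h.eq_zero_right hγ0 hγ1 h0 h1 hax)
  · have := h.comp_neg.eq_zero_right hγ0 hγ1 (a := -a) (x := -x) (by simpa using h0)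
      (by rw [deriv_comp_neg]; simpa using h1) (by linarith)
    exact hx (by simpa using this)

end IsEigenfunction

lemma hasDerivAt_rpow_add_one_div {γ x : ℝ} (hγ : 0 ≤ γ) (hx : 0 < x) :
    HasDerivAt (fun x : ℝ => x ^ (γ + 1) / (γ + 1)) (x ^ γ) x := by
  refine ((Real.hasDerivAt_rpow_const (Or.inl hx.ne')).div_const (γ + 1)).congr_deriv ?_
  have : γ + 1 ≠ 0 := by linarith
  rw [add_sub_cancel_right]
  field_simp

lemma not_integrable_of_le {f : ℝ → ℝ} {c a : ℝ} (hc : 0 < c) (h : ∀ x, a ≤ x → c ≤ f x) :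
    ¬ Integrable f := by
  intro hf
  have h1 : IntegrableOn (fun _ : ℝ => c) (Set.Ici a) := by
    refine Integrable.mono' hf.integrableOn aestronglyMeasurable_const ?_
    filter_upwards [ae_restrict_mem measurableSet_Ici] with x hx
    rw [Real.norm_of_nonneg hc.le]
    exact h x hx
  rw [integrableOn_const_iff] at h1
  simp [hc.ne'] at h1

/-! ### Barriers for the logarithmic derivative -/

/-- The approximate solution `lam x^{-γ} + b x^{-3γ}` of the Riccati equation of the log-derivative. -/
noncomputable def barrier (γ lam b x : ℝ) : ℝ := lam * x ^ (-γ) + b * x ^ (-(3 * γ))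

/-- The derivative of `barrier`. -/
noncomputable def barrierDeriv (γ lam b x : ℝ) : ℝ :=
  lam * (-γ * x ^ (-γ - 1)) + b * (-(3 * γ) * x ^ (-(3 * γ) - 1))

/-- The defect of `barrier` in the Riccati equation of the log-derivative. -/
noncomputable def barrierDefect (γ lam b x : ℝ) : ℝ :=
  x ^ γ * barrier γ lam b x - barrier γ lam b x ^ 2 - lam - barrierDeriv γ lam b x

lemma hasDerivAt_barrier (γ lam b : ℝ) {x : ℝ} (hx : 0 < x) :
    HasDerivAt (barrier γ lam b) (barrierDeriv γ lam b x) x :=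
  ((Real.hasDerivAt_rpow_const (Or.inl hx.ne')).const_mul lam).add
    ((Real.hasDerivAt_rpow_const (Or.inl hx.ne')).const_mul b)

lemma barrier_nonneg {γ lam b x : ℝ} (hlam : 0 ≤ lam) (hb : 0 ≤ b) (hx : 0 ≤ x) :
    0 ≤ barrier γ lam b x :=
  add_nonneg (mul_nonneg hlam (rpow_nonneg hx _)) (mul_nonneg hb (rpow_nonneg hx _))

lemma barrier_le {γ lam b x : ℝ} (hγ : 0 ≤ γ) (hb : 0 ≤ b) (hx : 1 ≤ x) :
    barrier γ lam b x ≤ (lam + b) * x ^ (-γ) := by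
  have : x ^ (-(3 * γ)) ≤ x ^ (-γ) := rpow_le_rpow_of_exponent_le hx (by linarith)
  have := mul_le_mul_of_nonneg_left this hb
  unfold barrier
  linarith

lemma tendsto_barrier {γ : ℝ} (hγ : 0 < γ) (lam b : ℝ) :
    Tendsto (barrier γ lam b) atTop (nhds 0) := by
  have h1 := (tendsto_rpow_neg_atTop hγ).const_mul lam
  have h2 := (tendsto_rpow_neg_atTop (by linarith : 0 < 3 * γ)).const_mul b
  have h3 := h1.add h2
  simp only [mul_zero, add_zero] at h3
  exact h3

lemma tendsto_barrierDefect {γ : ℝ} (hγ0 : 0 < γ) (hγ1 : γ < 1) (lam b : ℝ) :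
    Tendsto (fun x => barrierDefect γ lam b x * x ^ (2 * γ)) atTop (nhds (b - lam ^ 2)) := by
  have h1 := (tendsto_rpow_neg_atTop (by linarith : 0 < 2 * γ)).const_mul (2 * lam * b)
  have h2 := (tendsto_rpow_neg_atTop (by linarith : 0 < 4 * γ)).const_mul (b ^ 2)
  have h3 := (tendsto_rpow_neg_atTop (by linarith : 0 < 1 - γ)).const_mul (γ * lam)
  have h4 := (tendsto_rpow_neg_atTop (by linarith : 0 < γ + 1)).const_mul (3 * γ * b)
  have h5 := (((tendsto_const_nhds (x := b - lam ^ 2)).sub h1).sub h2).add h3 |>.add h4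
  simp only [mul_zero, sub_zero, add_zero] at h5
  refine h5.congr' ?_
  filter_upwards [eventually_gt_atTop 0] with x hx
  have hy : 0 < x ^ (-γ) := rpow_pos_of_pos hx _
  have npow (m : ℕ) : x ^ (-(m * γ)) = (x ^ (-γ)) ^ m := by
    rw [← rpow_natCast, ← rpow_mul hx.le]
    ring_nf
  have e1 : x ^ (-(3 * γ)) = (x ^ (-γ)) ^ 3 := by exact_mod_cast npow 3
  have e2 : x ^ (-(2 * γ)) = (x ^ (-γ)) ^ 2 := by exact_mod_cast npow 2
  have e3 : x ^ (-(4 * γ)) = (x ^ (-γ)) ^ 4 := by exact_mod_cast npow 4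
  have e4 : x ^ (2 * γ) = ((x ^ (-γ)) ^ 2)⁻¹ := by rw [← e2, rpow_neg hx.le, inv_inv]
  have e5 : x ^ γ = (x ^ (-γ))⁻¹ := by rw [rpow_neg hx.le, inv_inv]
  have e6 : x ^ (-(1 - γ)) = (x ^ (-γ))⁻¹ / x := by
    rw [← e5, ← rpow_sub_one hx.ne']
    ring_nf
  have e7 : x ^ (-(γ + 1)) = x ^ (-γ) / x := by
    rw [← rpow_sub_one hx.ne']
    ring_nf
  simp only [barrierDefect, barrier, barrierDeriv, rpow_sub_one hx.ne']
  rw [e6, e7, e1, e2, e3, e4, e5]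
  field_simp
  ring

namespace IsEigenfunction

variable {γ lam : ℝ} {ψ : ℝ → ℝ}

lemma hasDerivAt_deriv_sub_barrier_mul (h : IsEigenfunction γ lam ψ) (b : ℝ) {x : ℝ} (hx : 0 < x) :
    HasDerivAt (fun x => deriv ψ x - barrier γ lam b x * ψ x)
      ((x ^ γ - barrier γ lam b x) * (deriv ψ x - barrier γ lam b x * ψ x)
        + barrierDefect γ lam b x * ψ x) x := by
  have h1 := (h.hasDerivAt_deriv x).fun_sub
    ((hasDerivAt_barrier γ lam b hx).fun_mul (h.hasDerivAt x))
  have h2 : Vp γ x = x ^ γ := by simp [Vp, Real.sign_of_pos hx, abs_of_pos hx]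
  refine h1.congr_deriv ?_
  rw [h2, barrierDefect]
  ring

/-- Square integrability rules out exponential growth of the derivative. -/
lemma not_exp_le_deriv (h : IsEigenfunction γ lam ψ) (hγ0 : 0 < γ) (hγ1 : γ < 1) {a c : ℝ}
    (ha : 1 ≤ a) (hc : 0 < c) :
    ¬ ∀ x, a ≤ x → c * exp (3 / 4 * (x ^ (γ + 1) / (γ + 1))) ≤ deriv ψ x := by
  intro hle
  have hV := fun x (hx : a ≤ x) => hasDerivAt_rpow_add_one_div hγ0.le (show 0 < x by linarith)
  have hVx : ∀ x, a ≤ x → x ≤ 2 * (x ^ (γ + 1) / (γ + 1)) := by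
    intro x hx
    have h1 : x ≤ x ^ (γ + 1) := by
      simpa using rpow_le_rpow_of_exponent_le (ha.trans hx) (by linarith : 1 ≤ γ + 1)
    rw [mul_div_assoc', le_div_iff₀ (by linarith)]
    nlinarith
  have hgrow := fun x (hx : a ≤ x) => le_of_hasDerivAt_nonneg
    (fun y hy => (h.hasDerivAt y).fun_sub ((((hV y hy).const_mul (1 / 2)).exp).const_mul (c / 4)))
    (fun y hy => by
      have h1 : y ^ γ ≤ 8 * exp (1 / 4 * (y ^ (γ + 1) / (γ + 1))) := by
        have h2 : y ^ γ ≤ y := by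
          simpa using rpow_le_rpow_of_exponent_le (ha.trans hy) hγ1.le
        have h3 := add_one_le_exp (1 / 4 * (y ^ (γ + 1) / (γ + 1)))
        linarith [hVx y hy]
      have h4 := mul_le_mul_of_nonneg_left h1
        (mul_pos hc (exp_pos (1 / 2 * (y ^ (γ + 1) / (γ + 1))))).le
      have h5 : exp (1 / 2 * (y ^ (γ + 1) / (γ + 1))) * exp (1 / 4 * (y ^ (γ + 1) / (γ + 1)))
          = exp (3 / 4 * (y ^ (γ + 1) / (γ + 1))) := by
        rw [← exp_add]
        ring_nf
      have h6 := hle y hy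
      rw [← h5] at h6
      linarith) hx
  set C := c / 4 * exp (1 / 2 * (a ^ (γ + 1) / (γ + 1))) - ψ a with hC
  have hexp : Tendsto (fun x : ℝ => c / 8 * exp (1 / 2 * (x ^ (γ + 1) / (γ + 1)))) atTop atTop := by
    refine Tendsto.const_mul_atTop (by positivity) (tendsto_exp_atTop.comp ?_)
    exact ((tendsto_rpow_atTop (by linarith)).atTop_div_const (by linarith)).const_mul_atTop
      (by norm_num)
  obtain ⟨X, hX⟩ := eventually_atTop.1
    ((hexp.eventually_ge_atTop C).and (eventually_ge_atTop a))
  refine not_integrable_of_le (a := X) (c := (c / 8) ^ 2) (by positivity) ?_ h.sq_integrable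
  intro x hx
  obtain ⟨h1, h2⟩ := hX x hx
  have h3 : c / 8 * exp (1 / 2 * (x ^ (γ + 1) / (γ + 1))) ≤ ψ x := by
    have := hgrow x h2
    linarith
  have h4 : Vpot γ x = x ^ (γ + 1) / (γ + 1) := by
    rw [Vpot, abs_of_nonneg (by linarith)]
  have h5 := pow_le_pow_left₀ (by positivity) h3 2
  have h6 := mul_le_mul_of_nonneg_right h5 (exp_pos (-(x ^ (γ + 1) / (γ + 1)))).le
  rw [h4]
  refine le_trans (le_of_eq ?_) h6
  rw [mul_pow, mul_assoc, ← exp_nat_mul, ← exp_add]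
  simp

lemma eventually_deriv_le (h : IsEigenfunction γ lam ψ) (hγ0 : 0 < γ) (hγ1 : γ < 1)
    (hlam : 0 < lam) {b : ℝ} (hb : lam ^ 2 < b) :
    ∀ᶠ x in atTop, 0 ≤ ψ x → deriv ψ x ≤ barrier γ lam b x * ψ x := by
  have hev : ∀ᶠ x in atTop, 1 ≤ x ∧ barrier γ lam b x ≤ 1 / 4 ∧ 0 < barrierDefect γ lam b x := by
    filter_upwards [eventually_ge_atTop 1,
      (tendsto_barrier hγ0 lam b).eventually (ge_mem_nhds (by norm_num : (0 : ℝ) < 1 / 4)),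
      (tendsto_barrierDefect hγ0 hγ1 lam b).eventually (lt_mem_nhds (sub_pos.2 hb))]
      with x h1 h2 h3
    exact ⟨h1, h2, (pos_iff_pos_of_mul_pos h3).2 (rpow_pos_of_pos (by linarith) _)⟩
  obtain ⟨X, hX⟩ := eventually_atTop.1 hev
  filter_upwards [eventually_ge_atTop X] with a ha hψa
  by_contra! hlt
  have hX' : ∀ x, a ≤ x → 1 ≤ x ∧ barrier γ lam b x ≤ 1 / 4 ∧ 0 < barrierDefect γ lam b x :=
    fun x hx => hX x (ha.trans hx)
  have ha1 := (hX' a le_rfl).1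
  have hb0 : 0 ≤ b := (sq_nonneg lam).trans hb.le
  have hpow : ∀ x, a ≤ x → 1 ≤ x ^ γ := fun x hx => one_le_rpow (ha1.trans hx) hγ0.le
  have hu : ∀ x, a ≤ x → 0 ≤ barrier γ lam b x := fun x hx =>
    barrier_nonneg hlam.le hb0 (by linarith)
  have hF := fun x (hx : a ≤ x) =>
    h.hasDerivAt_deriv_sub_barrier_mul b (show 0 < x by linarith)
  set F : ℝ → ℝ := fun x => deriv ψ x - barrier γ lam b x * ψ x with hFdef
  have hFa : 0 < F a := sub_pos.2 hlt
  have hinv : ∀ x, a ≤ x → F a ≤ F x ∧ ψ a ≤ ψ x := fun x hx =>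
    forward_invariant hF (fun x _ => h.hasDerivAt x) (fun x hx h1 h2 => by
      have h3 : 0 < F x := hFa.trans_le h1
      have h4 : 0 ≤ ψ x := hψa.trans h2
      have h5 := hpow x hx
      obtain ⟨-, h6, h7⟩ := hX' x hx
      constructor
      · have := mul_pos (by linarith : 0 < x ^ γ - barrier γ lam b x) h3
        have := mul_nonneg h7.le h4
        simp only [hFdef] at *
        linarith
      · have := mul_nonneg (hu x hx) h4
        simp only [hFdef] at h3
        linarith) hx
  have hA := fun x (hx : a ≤ x) =>
    (hasDerivAt_rpow_add_one_div hγ0.le (show 0 < x by linarith)).const_mul (3 / 4)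
  refine h.not_exp_le_deriv hγ0 hγ1 ha1
    (c := F a * exp (-(3 / 4 * (a ^ (γ + 1) / (γ + 1))))) (by positivity) fun x hx => ?_
  have h1 := mul_exp_le_of_hasDerivAt hF hA (fun y hy => by
    obtain ⟨h1, h2⟩ := hinv y hy
    have h3 := hpow y hy
    obtain ⟨-, h6, h7⟩ := hX' y hy
    have h8 : 0 ≤ (1 / 4 * y ^ γ - barrier γ lam b y) * F y :=
      mul_nonneg (by linarith) (by linarith)
    have h9 := mul_nonneg h7.le (hψa.trans h2)
    simp only [hFdef] at *
    linarith) hx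
  rw [mul_assoc, ← exp_add, neg_add_eq_sub]
  have h2 := mul_nonneg (hu x hx) (hψa.trans (hinv x hx).2)
  simp only [hFdef] at *
  linarith

lemma eventually_ne_zero (h : IsEigenfunction γ lam ψ) (hγ0 : 0 < γ) (hγ1 : γ < 1)
    (hlam : 0 < lam) : ∀ᶠ x in atTop, ψ x ≠ 0 := by
  filter_upwards [h.eventually_deriv_le hγ0 hγ1 hlam (lt_add_one _),
    h.neg.eventually_deriv_le hγ0 hγ1 hlam (lt_add_one _)] with x h1 h2 h0
  refine h.deriv_ne_zero hγ0.le hγ1.le h0 ?_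
  have h3 : deriv (-ψ) x = -deriv ψ x := deriv.neg
  rw [h3] at h2
  simp only [Pi.neg_apply, h0, neg_zero, mul_zero, le_refl, true_implies] at h1 h2
  linarith

lemma eventually_pos_or_neg (h : IsEigenfunction γ lam ψ) (hγ0 : 0 < γ) (hγ1 : γ < 1)
    (hlam : 0 < lam) : (∀ᶠ x in atTop, 0 < ψ x) ∨ ∀ᶠ x in atTop, 0 < (-ψ) x := by
  obtain ⟨X, hX⟩ := eventually_atTop.1 (h.eventually_ne_zero hγ0 hγ1 hlam)
  have hcont : ContinuousOn ψ (Set.Ici X) := h.smooth.continuous.continuousOn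
  rcases lt_or_gt_of_ne (hX X le_rfl) with h0 | h0
  · right
    filter_upwards [eventually_ge_atTop X] with x hx
    by_contra hc
    simp only [Pi.neg_apply, not_lt, neg_nonpos] at hc
    obtain ⟨z, hz, hz0⟩ := isPreconnected_Ici.intermediate_value (Set.mem_Ici.2 le_rfl) hx hcont
      ⟨h0.le, hc⟩
    exact hX z hz hz0
  · left
    filter_upwards [eventually_ge_atTop X] with x hx
    by_contra! hc
    obtain ⟨z, hz, hz0⟩ := isPreconnected_Ici.intermediate_value hx (Set.mem_Ici.2 le_rfl) hcont
      ⟨hc, h0.le⟩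
    exact hX z hz hz0

lemma eventually_le_deriv (h : IsEigenfunction γ lam ψ) (hγ0 : 0 < γ) (hγ1 : γ < 1)
    {b : ℝ} (hb : b < lam ^ 2) (hψ : ∀ᶠ x in atTop, 0 < ψ x) :
    ∀ᶠ x in atTop, barrier γ lam b x * ψ x ≤ deriv ψ x := by
  have hev : ∀ᶠ x in atTop, 0 < ψ x ∧ 1 ≤ x ∧ 2 ≤ x ^ γ ∧ barrier γ lam b x ≤ 1 ∧
      barrierDefect γ lam b x < 0 := by
    filter_upwards [hψ, eventually_ge_atTop 1, (tendsto_rpow_atTop hγ0).eventually_ge_atTop 2,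
      (tendsto_barrier hγ0 lam b).eventually (ge_mem_nhds (by norm_num : (0 : ℝ) < 1)),
      (tendsto_barrierDefect hγ0 hγ1 lam b).eventually (gt_mem_nhds (sub_neg.2 hb))]
      with x h0 h1 h2 h3 h4
    exact ⟨h0, h1, h2, h3, (neg_iff_pos_of_mul_neg h4).2 (rpow_pos_of_pos (by linarith) _)⟩
  obtain ⟨X, hX⟩ := eventually_atTop.1 hev
  filter_upwards [eventually_ge_atTop X] with a ha
  by_contra! hlt
  have hX' := fun x (hx : a ≤ x) => hX x (ha.trans hx)
  have hG := fun x (hx : a ≤ x) =>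
    (h.hasDerivAt_deriv_sub_barrier_mul b (show 0 < x by linarith [(hX' x hx).2.1])).fun_neg
  set G : ℝ → ℝ := fun x => -(deriv ψ x - barrier γ lam b x * ψ x) with hGdef
  have hGa : 0 < G a := by
    simp only [hGdef]
    linarith
  have hG' : ∀ x, a ≤ x → 0 ≤ G x → G x ≤ -((x ^ γ - barrier γ lam b x) *
      (deriv ψ x - barrier γ lam b x * ψ x) + barrierDefect γ lam b x * ψ x) := by
    intro x hx hGx
    obtain ⟨h1, -, h2, h3, h4⟩ := hX' x hx
    have h5 := mul_nonneg (by linarith : 0 ≤ x ^ γ - barrier γ lam b x - 1) hGx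
    have h6 := mul_neg_of_neg_of_pos h4 h1
    simp only [hGdef] at *
    linarith
  have hinv : ∀ x, a ≤ x → G a ≤ G x := fun x hx =>
    (forward_invariant hG hG (fun x hx h1 _ => by
      have h2 := hGa.trans_le h1
      have h3 := h2.trans_le (hG' x hx h2.le)
      exact ⟨h3, h3⟩) hx).1
  have hexp : ∀ x, a ≤ x → G a * exp (x - a) ≤ G x := fun x hx =>
    mul_exp_le_of_hasDerivAt (A := fun x => x) (A' := fun _ => 1) hG
      (fun y _ => hasDerivAt_id' y)
      (fun y hy => by
        have := hG' y hy (hGa.le.trans (hinv y hy))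
        simpa only [one_mul] using this) hx
  have hdec : ∀ x, a ≤ x →
      -(ψ a * exp (-a)) - G a * exp (-a) * a ≤ -(ψ x * exp (-x)) - G a * exp (-a) * x := by
    intro x hx
    refine le_of_hasDerivAt_nonneg (f := fun x => -(ψ x * exp (-x)) - G a * exp (-a) * x)
      (f' := fun x => -(deriv ψ x * exp (-x) + ψ x * (exp (-x) * (-1))) - G a * exp (-a) * 1)
      (fun y _ => ((h.hasDerivAt y).fun_mul (hasDerivAt_neg' y).exp).fun_neg.fun_sub
        ((hasDerivAt_id' y).const_mul _)) (fun y hy => ?_) hx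
    have h1 := mul_le_mul_of_nonneg_right (hexp y hy) (exp_pos (-y)).le
    rw [mul_assoc, ← exp_add, show y - a + -y = -a by ring] at h1
    obtain ⟨h2, -, -, h3, -⟩ := hX' y hy
    have h4 : 0 ≤ (1 - barrier γ lam b y) * ψ y * exp (-y) :=
      mul_nonneg (mul_nonneg (by linarith) h2.le) (exp_pos _).le
    simp only [hGdef] at *
    linarith
  have hc : 0 < G a * exp (-a) := mul_pos hGa (exp_pos _)
  set x := a + ψ a * exp (-a) / (G a * exp (-a)) with hx
  have hψa := (hX' a le_rfl).1
  have hax : a ≤ x := by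
    have : 0 ≤ ψ a * exp (-a) / (G a * exp (-a)) := by positivity
    linarith
  have h1 := hdec x hax
  have h2 : G a * exp (-a) * x = G a * exp (-a) * a + ψ a * exp (-a) := by
    rw [hx, mul_add, mul_div_cancel₀ _ hc.ne']
  have h3 := mul_pos (hX' x hax).1 (exp_pos (-x))
  linarith

end IsEigenfunction

namespace IsEigenfunction

variable {γ lam mu x₀ : ℝ} {φ χ : ℝ → ℝ}

lemma tendsto_log_atTop (h : IsEigenfunction γ lam φ) (hγ0 : 0 < γ) (hγ1 : γ < 1)
    (hlam : 0 < lam) (hφ : ∀ᶠ x in atTop, 0 < φ x) :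
    Tendsto (fun x => log (φ x)) atTop atTop := by
  obtain ⟨a, ha⟩ := eventually_atTop.1
    ((hφ.and (h.eventually_le_deriv hγ0 hγ1 (pow_pos hlam 2) hφ)).and (eventually_ge_atTop 1))
  have hmono : ∀ x, a ≤ x → log (φ a) - lam * log a ≤ log (φ x) - lam * log x := fun x hx => by
    refine le_of_hasDerivAt_nonneg (f := fun x => log (φ x) - lam * log x)
      (f' := fun x => deriv φ x / φ x - lam * x⁻¹) (fun y hy => ?_) (fun y hy => ?_) hx
    · obtain ⟨⟨h1, -⟩, h3⟩ := ha y hy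
      exact ((h.hasDerivAt y).log h1.ne').fun_sub
        ((Real.hasDerivAt_log (by linarith)).const_mul lam)
    · obtain ⟨⟨h1, h2⟩, h3⟩ := ha y hy
      have h4 : y⁻¹ ≤ y ^ (-γ) := by
        rw [← rpow_neg_one]
        exact rpow_le_rpow_of_exponent_le h3 (by linarith)
      have h5 := mul_le_mul_of_nonneg_left h4 hlam.le
      rw [← le_div_iff₀ h1, barrier, zero_mul, add_zero] at h2
      linarith
  refine tendsto_atTop_mono' atTop (f₁ := fun x => (log (φ a) - lam * log a) + lam * log x) ?_
    (tendsto_atTop_add_const_left _ _ (Real.tendsto_log_atTop.const_mul_atTop hlam))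
  filter_upwards [eventually_ge_atTop a] with x hx
  linarith [hmono x hx]

lemma tendsto_log_sub_log_atBot (h : IsEigenfunction γ lam φ) (k : IsEigenfunction γ mu χ)
    (hγ0 : 0 < γ) (hγ1 : γ ≤ 1 / 3) (hlam : 0 < lam) (hmu : lam < mu)
    (hφ : ∀ᶠ x in atTop, 0 < φ x) (hχ : ∀ᶠ x in atTop, 0 < χ x) :
    Tendsto (fun x => log (φ x) - lam / mu * log (χ x)) atTop atBot := by
  have hmu0 : 0 < mu := hlam.trans hmu
  set η := lam * (mu - lam) / 3 with hη
  have hη0 : 0 < η := by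
    have := sub_pos.2 hmu
    positivity
  have hb : lam ^ 2 < lam * ((2 * lam + mu) / 3) := by nlinarith
  have hd : mu * ((lam + 2 * mu) / 3) < mu ^ 2 := by nlinarith
  obtain ⟨a, ha⟩ := eventually_atTop.1
    (((hφ.and (h.eventually_deriv_le hγ0 (by linarith) hlam hb)).and
      (hχ.and (k.eventually_le_deriv hγ0 (by linarith) hd hχ))).and (eventually_ge_atTop 1))
  have hmono : ∀ x, a ≤ x → -(log (φ a) - lam / mu * log (χ a)) - η * log a ≤
      -(log (φ x) - lam / mu * log (χ x)) - η * log x := fun x hx => by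
    refine le_of_hasDerivAt_nonneg
      (f := fun x => -(log (φ x) - lam / mu * log (χ x)) - η * log x)
      (f' := fun x => -(deriv φ x / φ x - lam / mu * (deriv χ x / χ x)) - η * x⁻¹)
      (fun y hy => ?_) (fun y hy => ?_) hx
    · obtain ⟨⟨⟨h1, -⟩, h2, -⟩, h3⟩ := ha y hy
      exact (((h.hasDerivAt y).log h1.ne').fun_sub
        (((k.hasDerivAt y).log h2.ne').const_mul _)).fun_neg.fun_sub
        ((Real.hasDerivAt_log (by linarith)).const_mul η)
    · obtain ⟨⟨⟨h1, h2⟩, h3, h4⟩, h5⟩ := ha y hy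
      have h6 : y⁻¹ ≤ y ^ (-(3 * γ)) := by
        rw [← rpow_neg_one]
        exact rpow_le_rpow_of_exponent_le h5 (by linarith)
      have h7 := mul_le_mul_of_nonneg_left h6 hη0.le
      have h8 := h2 h1.le
      rw [← div_le_iff₀ h1] at h8
      rw [← le_div_iff₀ h3] at h4
      have h9 := mul_le_mul_of_nonneg_left h4 (div_pos hlam hmu0).le
      have h10 : lam / mu * barrier γ mu (mu * ((lam + 2 * mu) / 3)) y -
          barrier γ lam (lam * ((2 * lam + mu) / 3)) y = η * y ^ (-(3 * γ)) := by
        rw [barrier, barrier, hη]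
        field_simp
        ring
      linarith
  refine tendsto_atBot_mono' atTop
    (f₁ := fun x => ((log (φ a) - lam / mu * log (χ a)) + η * log a) - η * log x) ?_ ?_
  · filter_upwards [eventually_ge_atTop a] with x hx
    linarith [hmono x hx]
  · simp only [sub_eq_add_neg]
    exact tendsto_atBot_add_const_left _ _
      (tendsto_neg_atTop_atBot.comp (Real.tendsto_log_atTop.const_mul_atTop hη0))

end IsEigenfunction

/-! ### Fourier coefficients -/

lemma tendsto_delta {γ : ℝ} (hγ0 : 0 < γ) (hγ1 : γ < 1) :
    Tendsto (delta γ) (nhdsWithin 0 (Set.Ioi 0)) (nhds 0) := by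
  have hp : 0 < (1 - γ) / (1 + γ) := div_pos (by linarith) (by linarith)
  have := (Real.continuousAt_rpow_const 0 ((1 - γ) / (1 + γ)) (Or.inr hp.le)).tendsto
  rw [zero_rpow hp.ne'] at this
  exact this.mono_left nhdsWithin_le_nhds

lemma tendsto_mul_rpow_atTop {γ x₀ : ℝ} (hγ0 : 0 < γ) (hx₀ : 0 < x₀) :
    Tendsto (fun ε : ℝ => x₀ * ε ^ (-(1 : ℝ) / (1 + γ))) (nhdsWithin 0 (Set.Ioi 0)) atTop := by
  refine Tendsto.const_mul_atTop hx₀ ?_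
  exact tendsto_rpow_neg_nhdsGT_zero (div_neg_of_neg_of_pos (by norm_num) (by linarith))

lemma fCoeff_neg (γ x₀ : ℝ) (ψ : ℝ → ℝ) (ε : ℝ) :
    fCoeff γ x₀ (-ψ) ε = -fCoeff γ x₀ ψ ε := by
  simp [fCoeff]

lemma fCoeff_comp_neg (γ x₀ : ℝ) (ψ : ℝ → ℝ) (ε : ℝ) :
    fCoeff γ (-x₀) (fun x => ψ (-x)) ε = fCoeff γ x₀ ψ ε := by
  have := intervalIntegral.integral_comp_neg (a := -x₀ - delta γ ε) (b := -x₀ + delta γ ε)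
    (fun x => ψ (x * ε ^ (-(1 : ℝ) / (1 + γ))))
  simp only [neg_mul] at this
  rw [fCoeff, fCoeff, this, neg_add, neg_sub, neg_neg, ← sub_eq_add_neg, sub_neg_eq_add,
    add_comm (delta γ ε)]

lemma delta_mul_rpow {γ ε : ℝ} (hγ : 0 < γ) (hε : 0 < ε) :
    delta γ ε * ε ^ (-(1 : ℝ) / (1 + γ)) = (ε ^ (-(1 : ℝ) / (1 + γ))) ^ γ := by
  have : 1 + γ ≠ 0 := by linarith
  rw [delta, ← rpow_add hε, ← rpow_mul hε.le]
  congr 1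
  field_simp
  ring

lemma fCoeff_mem_Icc {γ x₀ ε m M : ℝ} {ψ : ℝ → ℝ} (hψ : Continuous ψ) (hδ : 0 < delta γ ε)
    (h : ∀ x ∈ Set.Icc (x₀ - delta γ ε) (x₀ + delta γ ε),
      ψ (x * ε ^ (-(1 : ℝ) / (1 + γ))) ∈ Set.Icc m M) :
    fCoeff γ x₀ ψ ε ∈ Set.Icc m M := by
  have hle : x₀ - delta γ ε ≤ x₀ + delta γ ε := by linarith
  have hint : IntervalIntegrable (fun x => ψ (x * ε ^ (-(1 : ℝ) / (1 + γ)))) volume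
      (x₀ - delta γ ε) (x₀ + delta γ ε) :=
    (hψ.comp (continuous_id.mul continuous_const)).intervalIntegrable _ _
  have h1 := intervalIntegral.integral_mono_on hle (intervalIntegrable_const (c := m)) hint
    fun x hx => (h x hx).1
  have h2 := intervalIntegral.integral_mono_on hle hint (intervalIntegrable_const (c := M))
    fun x hx => (h x hx).2
  rw [intervalIntegral.integral_const, smul_eq_mul] at h1 h2
  rw [fCoeff, one_div_mul_eq_div]
  constructor
  · rw [le_div_iff₀ (by linarith)]
    linarith
  · rw [div_le_iff₀ (by linarith)]
    linarith

namespace IsEigenfunction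

variable {γ lam x₀ : ℝ} {φ ψ : ℝ → ℝ}

/-- On the averaging window, which has width `∼ X^γ` around `X` in the microscopic variable, an
eigenfunction varies only by a bounded factor. -/
lemma exists_abs_log_fCoeff_sub_le (h : IsEigenfunction γ lam φ) (hγ0 : 0 < γ) (hγ1 : γ < 1)
    (hlam : 0 < lam) (hφ : ∀ᶠ x in atTop, 0 < φ x) (hx₀ : 0 < x₀) :
    ∃ M, ∀ᶠ ε in nhdsWithin 0 (Set.Ioi 0), 0 < fCoeff γ x₀ φ ε ∧
      |log (fCoeff γ x₀ φ ε) - log (φ (x₀ * ε ^ (-(1 : ℝ) / (1 + γ))))| ≤ M := by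
  set K := lam + (lam ^ 2 + 1) with hK
  obtain ⟨a, ha⟩ := eventually_atTop.1
    ((hφ.and ((h.eventually_le_deriv hγ0 hγ1 (pow_pos hlam 2) hφ).and
      (h.eventually_deriv_le hγ0 hγ1 hlam (lt_add_one _)))).and (eventually_ge_atTop 1))
  set M := K * (x₀ / 2) ^ (-γ) with hM
  refine ⟨M, ?_⟩
  filter_upwards [(tendsto_delta hγ0 hγ1).eventually (ge_mem_nhds (half_pos hx₀)),
    (tendsto_mul_rpow_atTop hγ0 (half_pos hx₀)).eventually_ge_atTop a, self_mem_nhdsWithin]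
    with ε h1 h2 hε
  have hε0 : 0 < ε := hε
  have hδ : 0 < delta γ ε := rpow_pos_of_pos hε0 _
  set s := ε ^ (-(1 : ℝ) / (1 + γ)) with hs
  have hs0 : 0 < s := rpow_pos_of_pos hε0 _
  have hbound : ∀ y ∈ Set.Ici (x₀ / 2 * s), ‖deriv φ y / φ y‖ ≤ K * (x₀ / 2 * s) ^ (-γ) := by
    intro y hy
    obtain ⟨⟨h3, h4, h5⟩, h6⟩ := ha y (h2.trans hy)
    have h7 := h5 h3.le
    rw [← le_div_iff₀ h3] at h4
    rw [← div_le_iff₀ h3] at h7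
    have h8 : 0 ≤ barrier γ lam 0 y := barrier_nonneg hlam.le le_rfl (by linarith)
    rw [Real.norm_of_nonneg (h8.trans h4)]
    refine (h7.trans (barrier_le hγ0.le (by positivity) h6)).trans ?_
    refine mul_le_mul_of_nonneg_left ?_ (by positivity)
    exact rpow_le_rpow_of_nonpos (by positivity) hy (by linarith)
  have hvar : ∀ x ∈ Set.Icc (x₀ - delta γ ε) (x₀ + delta γ ε),
      0 < φ (x * s) ∧ |log (φ (x * s)) - log (φ (x₀ * s))| ≤ M := by
    intro x hx
    have hxs : x₀ / 2 * s ≤ x * s := by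
      gcongr
      linarith [hx.1]
    have hx₀s : x₀ / 2 * s ≤ x₀ * s := by
      gcongr
      linarith
    refine ⟨(ha _ (h2.trans hxs)).1.1, ?_⟩
    have h3 := (convex_Ici (x₀ / 2 * s)).norm_image_sub_le_of_norm_hasDerivWithin_le
      (f := fun y => log (φ y))
      (fun y hy => ((h.hasDerivAt y).log (ha y (h2.trans hy)).1.1.ne').hasDerivWithinAt)
      hbound (Set.mem_Ici.2 hx₀s) (Set.mem_Ici.2 hxs)
    rw [Real.norm_eq_abs] at h3
    refine h3.trans ?_
    have h4 : ‖x * s - x₀ * s‖ ≤ s ^ γ := by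
      rw [← delta_mul_rpow hγ0 hε0, ← sub_mul, norm_mul, Real.norm_of_nonneg hs0.le,
        Real.norm_eq_abs]
      gcongr
      rw [abs_le]
      constructor <;> linarith [hx.1, hx.2]
    calc _ ≤ K * (x₀ / 2 * s) ^ (-γ) * s ^ γ := by gcongr
      _ = M := by
        rw [mul_rpow (by positivity) hs0.le, hM, rpow_neg hs0.le]
        have : s ^ γ ≠ 0 := (rpow_pos_of_pos hs0 _).ne'
        field_simp
  have hpos : 0 < φ (x₀ * s) := (hvar x₀ (by constructor <;> linarith)).1
  have hmem : fCoeff γ x₀ φ ε ∈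
      Set.Icc (exp (log (φ (x₀ * s)) - M)) (exp (log (φ (x₀ * s)) + M)) := by
    refine fCoeff_mem_Icc h.smooth.continuous hδ fun x hx => ?_
    obtain ⟨h3, h4⟩ := hvar x hx
    rw [abs_le] at h4
    constructor
    · rw [← le_log_iff_exp_le h3]
      linarith
    · rw [← log_le_iff_le_exp h3]
      linarith
  have hc : 0 < fCoeff γ x₀ φ ε := (exp_pos _).trans_le hmem.1
  refine ⟨hc, ?_⟩
  have h3 := (le_log_iff_exp_le hc).2 hmem.1
  have h4 := (log_le_iff_le_exp hc).2 hmem.2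
  rw [abs_le]
  constructor <;> linarith

/-- Up to reflection and sign, an eigenfunction is positive near `+∞` and `x₀` is positive. -/
lemma exists_pos_of_fCoeff (h : IsEigenfunction γ lam ψ) (hγ0 : 0 < γ) (hγ1 : γ < 1)
    (hlam : 0 < lam) (x₀ : ℝ) :
    ∃ φ, IsEigenfunction γ lam φ ∧ (∀ᶠ x in atTop, 0 < φ x) ∧
      ∀ ε, |fCoeff γ |x₀| φ ε| = |fCoeff γ x₀ ψ ε| := by
  have key : ∀ ψ, IsEigenfunction γ lam ψ → ∃ φ, IsEigenfunction γ lam φ ∧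
      (∀ᶠ x in atTop, 0 < φ x) ∧ ∀ ε, |fCoeff γ |x₀| φ ε| = |fCoeff γ |x₀| ψ ε| := by
    intro ψ h
    rcases h.eventually_pos_or_neg hγ0 hγ1 hlam with hp | hp
    · exact ⟨ψ, h, hp, fun _ => rfl⟩
    · exact ⟨-ψ, h.neg, hp, fun ε => by rw [fCoeff_neg, abs_neg]⟩
  rcases abs_cases x₀ with ⟨h0, -⟩ | ⟨h0, -⟩
  · simpa only [h0] using key ψ h
  · obtain ⟨φ, h1, h2, h3⟩ := key _ h.comp_neg
    refine ⟨φ, h1, h2, fun ε => ?_⟩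
    rw [h3, h0, fCoeff_comp_neg]

/-- The logarithm of the Fourier coefficient is, up to `O(1)`, that of a positive eigenfunction. -/
lemma exists_abs_log_fCoeff (h : IsEigenfunction γ lam ψ) (hγ0 : 0 < γ) (hγ1 : γ < 1)
    (hlam : 0 < lam) (hx₀ : x₀ ≠ 0) :
    ∃ φ M, IsEigenfunction γ lam φ ∧ (∀ᶠ x in atTop, 0 < φ x) ∧
      ∀ᶠ ε in nhdsWithin 0 (Set.Ioi 0), 0 < |fCoeff γ x₀ ψ ε| ∧
        |log |fCoeff γ x₀ ψ ε| - log (φ (|x₀| * ε ^ (-(1 : ℝ) / (1 + γ))))| ≤ M := by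
  obtain ⟨φ, h1, h2, h3⟩ := h.exists_pos_of_fCoeff hγ0 hγ1 hlam x₀
  obtain ⟨M, hM⟩ := h1.exists_abs_log_fCoeff_sub_le hγ0 hγ1 hlam h2 (abs_pos.2 hx₀)
  refine ⟨φ, M, h1, h2, ?_⟩
  filter_upwards [hM] with ε hε
  rw [← h3 ε, abs_of_pos hε.1]
  exact hε

lemma tendsto_log_fCoeff (h : IsEigenfunction γ lam ψ) (hγ0 : 0 < γ) (hγ1 : γ < 1)
    (hlam : 0 < lam) (hx₀ : x₀ ≠ 0) :
    Tendsto (fun ε => log |fCoeff γ x₀ ψ ε|) (nhdsWithin 0 (Set.Ioi 0)) atTop := by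
  obtain ⟨φ, M, h1, h2, h3⟩ := h.exists_abs_log_fCoeff hγ0 hγ1 hlam hx₀
  refine tendsto_atTop_mono' _ (f₁ := fun ε =>
    log (φ (|x₀| * ε ^ (-(1 : ℝ) / (1 + γ)))) + -M) ?_
    (tendsto_atTop_add_const_right _ _ ((h1.tendsto_log_atTop hγ0 hγ1 hlam h2).comp
      (tendsto_mul_rpow_atTop hγ0 (abs_pos.2 hx₀))))
  filter_upwards [h3] with ε hε
  linarith [(abs_le.1 hε.2).1]

lemma tendsto_log_fCoeff_sub {mu : ℝ} {χ : ℝ → ℝ} (h : IsEigenfunction γ lam ψ)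
    (k : IsEigenfunction γ mu χ) (hγ0 : 0 < γ) (hγ1 : γ ≤ 1 / 3) (hlam : 0 < lam)
    (hmu : lam < mu) (hx₀ : x₀ ≠ 0) :
    Tendsto (fun ε => log |fCoeff γ x₀ ψ ε| - lam / mu * log |fCoeff γ x₀ χ ε|)
      (nhdsWithin 0 (Set.Ioi 0)) atBot := by
  have hmu0 : 0 < mu := hlam.trans hmu
  obtain ⟨φ, M, h1, h2, h3⟩ := h.exists_abs_log_fCoeff hγ0 (by linarith) hlam hx₀
  obtain ⟨θ, N, k1, k2, k3⟩ := k.exists_abs_log_fCoeff hγ0 (by linarith) hmu0 hx₀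
  refine tendsto_atBot_mono' _ (f₁ := fun ε =>
    (log (φ (|x₀| * ε ^ (-(1 : ℝ) / (1 + γ)))) -
      lam / mu * log (θ (|x₀| * ε ^ (-(1 : ℝ) / (1 + γ))))) + (M + lam / mu * N)) ?_
    (tendsto_atBot_add_const_right _ _ (
      (h1.tendsto_log_sub_log_atBot k1 hγ0 hγ1 hlam hmu h2 k2).comp
      (tendsto_mul_rpow_atTop hγ0 (abs_pos.2 hx₀))))
  filter_upwards [h3, k3] with ε hε kε
  have e1 := (abs_le.1 hε.2).2
  have e2 := mul_le_mul_of_nonneg_left (abs_le.1 kε.2).1 (div_pos hlam hmu0).le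
  linarith

/-- Evolution of a single mode up to the cut-off time of another one. -/
lemma eventually_mode_eq (h : IsEigenfunction γ lam ψ) (hγ0 : 0 < γ) (hγ1 : γ < 1)
    (hlam : 0 < lam) {mu : ℝ} (hmu : 0 < mu) (hx₀ : x₀ ≠ 0) (χ : ℝ → ℝ) (r : ℝ) :
    ∀ᶠ ε in nhdsWithin 0 (Set.Ioi 0),
      exp (-2 * (lam * ε ^ ((γ - 1) / (γ + 1))) * (cutoffTime γ mu x₀ χ ε + r * delta γ ε))
          * (fCoeff γ x₀ ψ ε) ^ 2 =
        exp (2 * (log |fCoeff γ x₀ ψ ε| - lam / mu * log |fCoeff γ x₀ χ ε|) + -2 * lam * r) := by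
  filter_upwards [(h.tendsto_log_fCoeff hγ0 hγ1 hlam hx₀).eventually_gt_atTop 0,
    self_mem_nhdsWithin] with ε hε hε0
  have hc : 0 < |fCoeff γ x₀ ψ ε| := zero_lt_one.trans ((log_pos_iff (abs_nonneg _)).1 hε)
  have hp : 0 < ε ^ ((γ - 1) / (γ + 1)) := rpow_pos_of_pos hε0 _
  have hd : ε ^ ((γ - 1) / (γ + 1)) * delta γ ε = 1 := by
    rw [delta, ← rpow_add hε0, add_comm 1 γ, ← add_div]
    simp
  have hsq : (fCoeff γ x₀ ψ ε) ^ 2 = exp (2 * log |fCoeff γ x₀ ψ ε|) := by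
    rw [two_mul, exp_add, exp_log hc, ← sq, sq_abs]
  rw [hsq, ← exp_add]
  congr 1
  have h1 : lam * ε ^ ((γ - 1) / (γ + 1)) * cutoffTime γ mu x₀ χ ε =
      lam / mu * log |fCoeff γ x₀ χ ε| := by
    rw [cutoffTime]
    field_simp
  linear_combination (-2) * h1 - 2 * lam * r * hd

end IsEigenfunction

/-- **Profile cut-off for the Galerkin-projected χ²-distance, `0 < γ ≤ 1/3`,
`x₀ ≠ 0`.**  For small `ε` the cut-off time `t_ε = λ_{n,ε}^{−1} log|c_{n,ε}|`
is well defined and positive, and with window `w_ε = ε^{(1−γ)/(1+γ)}` one has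
profile cut-off: `d_{n,ε}(t_ε + r w_ε) → e^{−λ_n r}` as `ε → 0`, for every
`r ∈ ℝ`. -/
theorem stmt19 (γ x₀ : ℝ) (hγ : γ ∈ Set.Ioc (0 : ℝ) (1 / 3)) (hx₀ : x₀ ≠ 0)
    (n : ℕ) (hn : 1 ≤ n) (lam : ℕ → ℝ) (ψ : ℕ → ℝ → ℝ)
    (hlam1 : 0 < lam 1)
    (hlam_mono : ∀ k, 1 ≤ k → k < n → lam k < lam (k + 1))
    (hψ_smooth : ∀ k ∈ Finset.Icc 1 n, ContDiff ℝ 2 (ψ k))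
    (hψ_ne : ∀ k ∈ Finset.Icc 1 n, ∃ x, ψ k x ≠ 0)
    (hψ_ode : ∀ k ∈ Finset.Icc 1 n, ∀ x : ℝ,
      -(deriv (deriv (ψ k)) x) + Vp γ x * deriv (ψ k) x = lam k * ψ k x)
    (hψ_L2 : ∀ k ∈ Finset.Icc 1 n,
      Integrable (fun x => (ψ k x) ^ 2 * Real.exp (-(Vpot γ x)))) :
    (∃ ε₀ : ℝ, 0 < ε₀ ∧ ∀ ε : ℝ, 0 < ε → ε < ε₀ →
      1 < |fCoeff γ x₀ (ψ n) ε| ∧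
      0 < cutoffTime γ (lam n) x₀ (ψ n) ε) ∧
    (∀ r : ℝ,
      Tendsto (fun ε : ℝ =>
          truncDist γ n lam ψ x₀ ε
            (cutoffTime γ (lam n) x₀ (ψ n) ε + r * delta γ ε))
        (nhdsWithin 0 (Set.Ioi 0))
        (nhds (Real.exp (-(lam n) * r)))) := by
  obtain ⟨hγ0, hγ1⟩ := hγ
  have heig : ∀ k ∈ Finset.Icc 1 n, IsEigenfunction γ (lam k) (ψ k) := fun k hk =>
    ⟨hψ_smooth k hk, hψ_ne k hk, hψ_ode k hk, hψ_L2 k hk⟩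
  have hmono : StrictMonoOn lam (Set.Icc 1 n) := by
    refine strictMonoOn_of_lt_add_one Set.ordConnected_Icc fun k _ hk hk' => ?_
    exact hlam_mono k hk.1 hk'.2
  have hpos : ∀ k ∈ Finset.Icc 1 n, 0 < lam k := fun k hk => by
    rw [Finset.mem_Icc] at hk
    exact hlam1.trans_le (hmono.monotoneOn ⟨le_rfl, hn⟩ hk hk.1)
  have hnmem : n ∈ Finset.Icc 1 n := Finset.mem_Icc.2 ⟨hn, le_rfl⟩
  have hlog := (heig n hnmem).tendsto_log_fCoeff hγ0 (by linarith) (hpos n hnmem) hx₀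
  refine ⟨?_, fun r => ?_⟩
  · obtain ⟨ε₀, hε₀, hsub⟩ := mem_nhdsGT_iff_exists_Ioo_subset.1 (hlog.eventually_gt_atTop 0)
    refine ⟨ε₀, hε₀, fun ε h1 h2 => ?_⟩
    have h3 : 0 < log |fCoeff γ x₀ (ψ n) ε| := hsub ⟨h1, h2⟩
    refine ⟨(log_pos_iff (abs_nonneg _)).1 h3, ?_⟩
    have := hpos n hnmem
    have := rpow_pos_of_pos h1 ((γ - 1) / (γ + 1))
    unfold cutoffTime
    positivity
  · have hsum : Tendsto (fun ε : ℝ => ∑ k ∈ Finset.Icc 1 n,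
        Real.exp (-2 * (lam k * ε ^ ((γ - 1) / (γ + 1))) *
            (cutoffTime γ (lam n) x₀ (ψ n) ε + r * delta γ ε))
          * (fCoeff γ x₀ (ψ k) ε) ^ 2) (nhdsWithin 0 (Set.Ioi 0))
        (nhds (∑ k ∈ Finset.Icc 1 n, if k = n then Real.exp (-2 * lam n * r) else 0)) := by
      refine tendsto_finsetSum _ fun k hk => ?_
      have hterm := (heig k hk).eventually_mode_eq hγ0 (by linarith) (hpos k hk) (hpos n hnmem)
        hx₀ (ψ n) r
      refine Tendsto.congr' (EventuallyEq.symm hterm) ?_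
      split_ifs with hkn
      · subst hkn
        have := (hpos k hk).ne'
        simp [this]
      · rw [Finset.mem_Icc] at hk
        have hlt : lam k < lam n :=
          hmono hk ⟨hn, le_rfl⟩ (lt_of_le_of_ne hk.2 hkn)
        have hk' := Finset.mem_Icc.2 hk
        have h1 := (heig k hk').tendsto_log_fCoeff_sub (heig n hnmem) hγ0 hγ1 (hpos k hk') hlt hx₀
        exact tendsto_exp_atBot.comp
          (tendsto_atBot_add_const_right _ _ (h1.const_mul_atBot two_pos))
    have hsqrt := (Real.continuous_sqrt.tendsto _).comp hsum
    rw [Finset.sum_ite_eq' _ n, if_pos hnmem,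
      show -2 * lam n * r = -lam n * r + -lam n * r by ring, exp_add,
      Real.sqrt_mul_self (exp_pos _).le] at hsqrt
    exact hsqrt
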